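/- For every positive rational number q with q ≠ 1, one has the strict inequality ∑_{d : σ(d)/d = q} 1/d < 1, where the sum ranges over all natural numbers d ≥ 1 with σ(d)/d = q; equality in the bound ∑_{d : σ(d)/d = q} 1/d ≤ 1 can only occur when q = 1. -/

import Mathlib

open scoped BigOperators ENNReal

/-- The sum-of-divisors function `σ(n) = ∑_{d ∣ n} d`. -/
def sigma1 (n : ℕ) : ℕ := ∑ d ∈ n.divisors, d

/-- The abundancy index `σ(n) / n`. -/
def abundancy (n : ℕ) : ℚ := (sigma1 n : ℚ) / n

/-- The `n`-rough positive integers below `N` of abundancy index `q`. -/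
def levelSet (N n : ℕ) (q : ℚ) : Finset ℕ :=
  (Finset.range N).filter fun d =>
    0 < d ∧ abundancy d = q ∧ ∀ r ∈ d.primeFactors, n ≤ r

/-- The sum of the reciprocals of the elements of `levelSet N n q`. -/
noncomputable def reciprocalSum (N n : ℕ) (q : ℚ) : ℝ :=
  ∑ d ∈ levelSet N n q, (1 : ℝ) / d

theorem mem_levelSet {N n d : ℕ} {q : ℚ} : d ∈ levelSet N n q ↔
    d < N ∧ 0 < d ∧ abundancy d = q ∧ ∀ r ∈ d.primeFactors, n ≤ r := by
  simp [levelSet]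

theorem sigma1_eq_sigma (n : ℕ) : sigma1 n = ArithmeticFunction.sigma 1 n := by
  simp [sigma1, ArithmeticFunction.sigma_apply]

theorem sigma1_pos {n : ℕ} (hn : 0 < n) : 0 < sigma1 n :=
  Finset.sum_pos (fun _ hd => Nat.pos_of_mem_divisors hd) ⟨1, by simp [hn.ne']⟩

theorem abundancy_pos {n : ℕ} (hn : 0 < n) : 0 < abundancy n := by
  have := sigma1_pos hn
  unfold abundancy
  positivity

theorem abundancy_mul {a b : ℕ} (h : a.Coprime b) :
    abundancy (a * b) = abundancy a * abundancy b := by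
  simp only [abundancy, sigma1_eq_sigma,
    ArithmeticFunction.isMultiplicative_sigma.map_mul_of_coprime h]
  push_cast
  rw [mul_div_mul_comm]

theorem eq_one_of_abundancy_eq_one {n : ℕ} (hn : 0 < n) (h : abundancy n = 1) : n = 1 := by
  by_contra h1
  have hσ : sigma1 n = n := by
    unfold abundancy at h
    rw [div_eq_one_iff_eq (by positivity)] at h
    exact_mod_cast h
  have hle : ∑ d ∈ ({1, n} : Finset ℕ), d ≤ sigma1 n := by
    apply Finset.sum_le_sum_of_subset
    intro x hx
    simp only [Finset.mem_insert, Finset.mem_singleton] at hx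
    rcases hx with rfl | rfl <;> simp [hn.ne']
  rw [Finset.sum_pair (Ne.symm h1)] at hle
  omega

theorem den_dvd_of_abundancy_eq {n : ℕ} {q : ℚ} (h : abundancy n = q) : q.den ∣ n := by
  have hdvd := Rat.den_dvd (sigma1 n : ℤ) n
  rw [Rat.divInt_eq_div, Int.cast_natCast, Int.cast_natCast] at hdvd
  rw [← h, abundancy]
  exact Int.natCast_dvd_natCast.1 hdvd

theorem not_prime_dvd_sigma1_pow {p : ℕ} (hp : p.Prime) (k : ℕ) : ¬ p ∣ sigma1 (p ^ k) := by
  rw [sigma1, Nat.sum_divisors_prime_pow hp, Finset.sum_range_succ']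
  intro h
  have h1 : p ∣ ∑ i ∈ Finset.range k, p ^ (i + 1) :=
    Finset.dvd_sum fun i _ => dvd_pow_self p (by omega)
  rw [Nat.dvd_add_right h1] at h
  exact hp.one_lt.ne' (by simpa using h)

theorem den_abundancy_prime_pow_ne_one {p k : ℕ} (hp : p.Prime) (hk : 1 ≤ k) :
    (abundancy (p ^ k)).den ≠ 1 := by
  intro h
  have hq : ((abundancy (p ^ k)).num : ℚ) = abundancy (p ^ k) := (Rat.den_eq_one_iff _).1 h
  have hpk : ((p ^ k : ℕ) : ℚ) ≠ 0 := by exact_mod_cast (pow_pos hp.pos k).ne'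
  have h2 : ((abundancy (p ^ k)).num : ℚ) * ((p ^ k : ℕ) : ℚ) = sigma1 (p ^ k) := by
    rw [hq, abundancy, div_mul_cancel₀ _ hpk]
  have h3 : (abundancy (p ^ k)).num * ((p ^ k : ℕ) : ℤ) = sigma1 (p ^ k) := by exact_mod_cast h2
  apply not_prime_dvd_sigma1_pow hp k
  have h4 : ((p ^ k : ℕ) : ℤ) ∣ sigma1 (p ^ k) := ⟨_, by rw [← h3, mul_comm]⟩
  exact (dvd_pow_self p (by omega)).trans (Int.natCast_dvd_natCast.1 h4)

theorem reciprocalSum_one_le (N n : ℕ) : reciprocalSum N n 1 ≤ 1 := by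
  have hsub : levelSet N n 1 ⊆ {1} := by
    intro d hd
    rw [mem_levelSet] at hd
    simpa using eq_one_of_abundancy_eq_one hd.2.1 hd.2.2.1
  calc reciprocalSum N n 1 ≤ ∑ d ∈ ({1} : Finset ℕ), (1 : ℝ) / d :=
        Finset.sum_le_sum_of_subset_of_nonneg hsub fun _ _ _ => by positivity
    _ = 1 := by simp

theorem sum_Icc_inv_pow_le {x : ℝ} (hx : 1 < x) (N : ℕ) :
    ∑ k ∈ Finset.Icc 1 N, (1 / x) ^ k ≤ 1 / (x - 1) := by
  have hx0 : 0 < x := by linarith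
  have hx1 : 0 < x - 1 := by linarith
  suffices h : ∑ k ∈ Finset.Icc 1 N, (1 / x) ^ k = (1 - (1 / x) ^ N) / (x - 1) by
    rw [h]
    gcongr
    linarith [show 0 ≤ (1 / x) ^ N by positivity]
  induction N with
  | zero => simp
  | succ N ih =>
    rw [Finset.sum_Icc_succ_top (by omega), ih, pow_succ]
    field_simp
    ring

/-- Grouping the multiples of `p` in a level set according to the exponent of `p`. -/
theorem sum_filter_dvd_levelSet_le {p n n' : ℕ} (hp : p.Prime)
    (hn : ∀ r, n ≤ r → r ≠ p → n' ≤ r) (N : ℕ) (q : ℚ) :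
    ∑ d ∈ (levelSet (N + 1) n q).filter (p ∣ ·), (1 : ℝ) / d ≤
      ∑ k ∈ Finset.Icc 1 N,
        (1 / (p : ℝ)) ^ k * reciprocalSum N n' (q / abundancy (p ^ k)) := by
  have hinj : ∀ d : ℕ, p ^ d.factorization p * (d / p ^ d.factorization p) = d :=
    fun d => Nat.ordProj_mul_ordCompl_eq_self d p
  simp only [reciprocalSum, Finset.mul_sum]
  rw [Finset.sum_sigma']
  set g : ℕ → (_ : ℕ) × ℕ := fun d => ⟨d.factorization p, d / p ^ d.factorization p⟩ with hg
  have hg_inj : Function.Injective g := by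
    intro a b hab
    simp only [hg, Sigma.mk.injEq, heq_eq_eq] at hab
    rw [← hinj a, ← hinj b, hab.2, hab.1]
  have hsum : ∑ d ∈ (levelSet (N + 1) n q).filter (p ∣ ·), (1 : ℝ) / d =
      ∑ x ∈ ((levelSet (N + 1) n q).filter (p ∣ ·)).image g,
        (1 / (p : ℝ)) ^ x.1 * (1 / (x.2 : ℝ)) := by
    rw [Finset.sum_image hg_inj.injOn]
    refine Finset.sum_congr rfl fun d _ => ?_
    have h : (d : ℝ) = (p : ℝ) ^ d.factorization p * ((d / p ^ d.factorization p : ℕ) : ℝ) := by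
      exact_mod_cast (hinj d).symm
    conv_lhs => rw [h]
    rw [one_div_pow, one_div_mul_one_div]
  rw [hsum]
  apply Finset.sum_le_sum_of_subset_of_nonneg
  · intro x hx
    simp only [Finset.mem_image, Finset.mem_filter, mem_levelSet] at hx
    obtain ⟨d, ⟨⟨hdN, hd0, hdq, hdr⟩, hpd⟩, rfl⟩ := hx
    have hk : 1 ≤ d.factorization p := hp.factorization_pos_of_dvd hd0.ne' hpd
    have hkd : d.factorization p < d := Nat.factorization_lt p hd0.ne'
    have hm0 : 0 < d / p ^ d.factorization p := Nat.ordCompl_pos p hd0.ne'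
    have hmd : d / p ^ d.factorization p < d :=
      Nat.div_lt_self hd0 (Nat.one_lt_pow (by omega) hp.one_lt)
    have hcop : (p ^ d.factorization p).Coprime (d / p ^ d.factorization p) :=
      (Nat.coprime_ordCompl hp hd0.ne').pow_left _
    have hab := abundancy_mul hcop
    rw [hinj, hdq] at hab
    simp only [hg, Finset.mem_sigma, Finset.mem_Icc, mem_levelSet]
    refine ⟨⟨hk, by omega⟩, by omega, hm0, ?_, ?_⟩
    · rw [hab, mul_div_cancel_left₀ _ (abundancy_pos (pow_pos hp.pos _)).ne']
    · intro r hr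
      refine hn r (hdr r (Nat.primeFactors_mono (Nat.ordCompl_dvd d p) hd0.ne' hr)) ?_
      rintro rfl
      exact Nat.not_dvd_ordCompl hp hd0.ne' (Nat.dvd_of_mem_primeFactors hr)
  · intro x _ _
    positivity

theorem sum_filter_dvd_levelSet_le_mul {p n n' : ℕ} (hp : p.Prime)
    (hn : ∀ r, n ≤ r → r ≠ p → n' ≤ r) {N : ℕ} {q : ℚ} {c : ℝ} (hc : 0 ≤ c)
    (h : ∀ k, 1 ≤ k → reciprocalSum N n' (q / abundancy (p ^ k)) ≤ c) :
    ∑ d ∈ (levelSet (N + 1) n q).filter (p ∣ ·), (1 : ℝ) / d ≤ 1 / ((p : ℝ) - 1) * c := by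
  refine (sum_filter_dvd_levelSet_le hp hn N q).trans ?_
  calc _ ≤ ∑ k ∈ Finset.Icc 1 N, (1 / (p : ℝ)) ^ k * c :=
        Finset.sum_le_sum fun k hk =>
          mul_le_mul_of_nonneg_left (h k (Finset.mem_Icc.1 hk).1) (by positivity)
    _ = (∑ k ∈ Finset.Icc 1 N, (1 / (p : ℝ)) ^ k) * c := by rw [Finset.sum_mul]
    _ ≤ _ := mul_le_mul_of_nonneg_right
        (sum_Icc_inv_pow_le (by exact_mod_cast hp.one_lt) N) hc

theorem filter_dvd_levelSet_eq_self {p : ℕ} {q : ℚ} (hpq : p ∣ q.den) (N n : ℕ) :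
    (levelSet N n q).filter (p ∣ ·) = levelSet N n q :=
  Finset.filter_true_of_mem fun _ hd =>
    hpq.trans (den_dvd_of_abundancy_eq (mem_levelSet.1 hd).2.2.1)

theorem reciprocalSum_le_add (N n : ℕ) (q : ℚ) :
    reciprocalSum N n q ≤
      ∑ d ∈ (levelSet N n q).filter (n ∣ ·), (1 : ℝ) / d + reciprocalSum N (n + 1) q := by
  rw [reciprocalSum, ← Finset.sum_filter_add_sum_filter_not _ (n ∣ ·)]
  gcongr
  refine Finset.sum_le_sum_of_subset_of_nonneg ?_ fun _ _ _ => by positivity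
  intro d hd
  simp only [Finset.mem_filter, mem_levelSet] at hd ⊢
  obtain ⟨⟨h1, h2, h3, h4⟩, h5⟩ := hd
  refine ⟨h1, h2, h3, fun r hr => lt_of_le_of_ne (h4 r hr) ?_⟩
  rintro rfl
  exact h5 (Nat.dvd_of_mem_primeFactors hr)

theorem reciprocalSum_le_succ_of_not_prime {n : ℕ} (hn : ¬ n.Prime) (N : ℕ) (q : ℚ) :
    reciprocalSum N n q ≤ reciprocalSum N (n + 1) q := by
  refine Finset.sum_le_sum_of_subset_of_nonneg ?_ fun _ _ _ => by positivity
  intro d hd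
  rw [mem_levelSet] at hd ⊢
  refine ⟨hd.1, hd.2.1, hd.2.2.1, fun r hr => lt_of_le_of_ne (hd.2.2.2 r hr) ?_⟩
  rintro rfl
  exact hn (Nat.prime_of_mem_primeFactors hr)

theorem reciprocalSum_eq_zero_of_le {N n : ℕ} (h : N ≤ n) {q : ℚ} (hq : q ≠ 1) :
    reciprocalSum N n q = 0 := by
  refine Finset.sum_eq_zero fun d hd => ?_
  obtain ⟨h1, h2, h3, h4⟩ := mem_levelSet.1 hd
  exfalso
  have hd1 : d ≠ 1 := by
    rintro rfl
    exact hq (by simp [← h3, abundancy, sigma1])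
  have := h4 d.minFac (Nat.mem_primeFactors.2 ⟨Nat.minFac_prime hd1, d.minFac_dvd, h2.ne'⟩)
  have := Nat.minFac_le h2
  omega

theorem div_abundancy_prime_pow_ne_one {q : ℚ} (hq : q.den = 1) {p k : ℕ} (hp : p.Prime)
    (hk : 1 ≤ k) : q / abundancy (p ^ k) ≠ 1 := by
  intro h
  rw [div_eq_one_iff_eq (abundancy_pos (pow_pos hp.pos k)).ne'] at h
  exact den_abundancy_prime_pow_ne_one hp hk (h ▸ hq)

/-- If the reciprocal sums below `N` satisfy the expected bound, then for an integer `q` the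
`p`-rough part below `N + 1` exceeds the `(p + 1)`-rough part by at most `1 / ((p - 1) p)`. -/
theorem reciprocalSum_succ_le_of_den_eq_one {N : ℕ}
    (ih : ∀ n q, 2 ≤ n → q ≠ 1 → reciprocalSum N n q ≤ 1 / ((n : ℝ) - 1))
    {q : ℚ} (hq : q.den = 1) {p : ℕ} (hp : p.Prime) :
    reciprocalSum (N + 1) p q ≤
      1 / ((p : ℝ) - 1) * (1 / p) + reciprocalSum (N + 1) (p + 1) q := by
  refine (reciprocalSum_le_add _ _ _).trans ?_
  gcongr
  refine sum_filter_dvd_levelSet_le_mul hp (n' := p + 1) (fun r h1 h2 => by omega)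
    (by positivity) fun k hk => ?_
  have := ih (p + 1) _ (by have := hp.two_le; omega)
    (div_abundancy_prime_pow_ne_one hq hp hk)
  simpa using this

theorem reciprocalSum_le_of_prime_dvd_den {N n : ℕ} (h : ∀ q, reciprocalSum N n q ≤ 1)
    {p : ℕ} (hp : p.Prime) {q : ℚ} (hpq : p ∣ q.den) :
    reciprocalSum (N + 1) n q ≤ 1 / ((p : ℝ) - 1) := by
  rw [reciprocalSum, ← filter_dvd_levelSet_eq_self hpq]
  simpa using sum_filter_dvd_levelSet_le_mul hp (n := n) (n' := n) (N := N) (q := q)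
    (fun r h1 _ => h1) zero_le_one fun k _ => h _

theorem reciprocalSum_le (N n : ℕ) (q : ℚ) (hn : 2 ≤ n) (hq : q ≠ 1) :
    reciprocalSum N n q ≤ 1 / ((n : ℝ) - 1) := by
  induction N generalizing n q with
  | zero =>
    have : (2 : ℝ) ≤ n := by exact_mod_cast hn
    simp [reciprocalSum, levelSet]
    linarith
  | succ N ih =>
    by_cases hden : q.den = 1
    · by_cases hNn : N + 1 ≤ n
      · have : (2 : ℝ) ≤ n := by exact_mod_cast hn
        rw [reciprocalSum_eq_zero_of_le hNn hq]
        exact one_div_nonneg.2 (by linarith)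
      · have hle : n ≤ N + 1 := by omega
        clear hNn
        revert hn
        induction hle using Nat.decreasingInduction with
        | self =>
          intro hn
          rw [reciprocalSum_eq_zero_of_le le_rfl hq]
          have : (2 : ℝ) ≤ ((N + 1 : ℕ) : ℝ) := by exact_mod_cast hn
          exact one_div_nonneg.2 (by linarith)
        | of_succ n _ ihn =>
          intro hn
          have hn' : (2 : ℝ) ≤ n := by exact_mod_cast hn
          have h1 := ihn (by omega)
          push_cast at h1
          rw [add_sub_cancel_right] at h1
          have h0 : (n : ℝ) - 1 ≠ 0 := by linarith
          have hid : 1 / ((n : ℝ) - 1) * (1 / n) + 1 / n = 1 / ((n : ℝ) - 1) := by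
            field_simp
            ring
          by_cases hp : n.Prime
          · linarith [reciprocalSum_succ_le_of_den_eq_one ih hden hp]
          · have : 0 ≤ 1 / ((n : ℝ) - 1) * (1 / n) :=
              mul_nonneg (one_div_nonneg.2 (by linarith)) (by positivity)
            linarith [reciprocalSum_le_succ_of_not_prime hp (N + 1) q]
    · have hp := Nat.minFac_prime hden
      have hn' : (2 : ℝ) ≤ n := by exact_mod_cast hn
      by_cases hnp : n ≤ q.den.minFac
      · have hnp' : (n : ℝ) ≤ q.den.minFac := by exact_mod_cast hnp
        refine (reciprocalSum_le_of_prime_dvd_den (fun q' => ?_) hp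
          (Nat.minFac_dvd _)).trans ?_
        · by_cases hq' : q' = 1
          · exact hq' ▸ reciprocalSum_one_le N n
          · refine (ih n q' hn hq').trans ?_
            rw [div_le_one (by linarith)]
            linarith
        · exact one_div_le_one_div_of_le (by linarith) (by linarith)
      · have hempty : reciprocalSum (N + 1) n q = 0 := by
          refine Finset.sum_eq_zero fun d hd => ?_
          obtain ⟨_, h2, h3, h4⟩ := mem_levelSet.1 hd
          exact absurd (h4 _ (Nat.mem_primeFactors.2
            ⟨hp, (Nat.minFac_dvd _).trans (den_dvd_of_abundancy_eq h3), h2.ne'⟩)) hnp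
        rw [hempty]
        exact one_div_nonneg.2 (by linarith)

theorem reciprocalSum_le_one {N n : ℕ} (hn : 2 ≤ n) (q : ℚ) : reciprocalSum N n q ≤ 1 := by
  by_cases hq : q = 1
  · exact hq ▸ reciprocalSum_one_le N n
  · have hn' : (2 : ℝ) ≤ n := by exact_mod_cast hn
    refine (reciprocalSum_le N n q hn hq).trans ?_
    rw [div_le_one (by linarith)]
    linarith

theorem reciprocalSum_le_of_two_dvd_den {N : ℕ} (hN : 2 ≤ N) {q : ℚ} (h2 : 2 ∣ q.den) :
    reciprocalSum (N + 1) 2 q ≤ 7 / 8 := by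
  have hle := sum_filter_dvd_levelSet_le Nat.prime_two (n := 2) (n' := 3)
    (fun r _ _ => by omega) N q
  rw [filter_dvd_levelSet_eq_self h2] at hle
  refine hle.trans ?_
  push_cast
  set a : ℕ → ℝ := fun k => reciprocalSum N 3 (q / abundancy (2 ^ k)) with ha
  have ha1 : ∀ k, a k ≤ 1 := fun k => reciprocalSum_le_one (by norm_num) _
  obtain ⟨j, hj1, hj2, haj⟩ : ∃ j, 1 ≤ j ∧ j ≤ 2 ∧ a j ≤ 1 / 2 := by
    by_cases h1 : q / abundancy (2 ^ 1) = 1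
    · refine ⟨2, by norm_num, le_rfl, ?_⟩
      refine (reciprocalSum_le N 3 _ (by norm_num) fun h => ?_).trans (by norm_num)
      rw [div_eq_one_iff_eq (abundancy_pos (by norm_num)).ne'] at h h1
      have e1 : abundancy (2 ^ 1) = 3 / 2 := by
        rw [abundancy, show sigma1 (2 ^ 1) = 3 by decide]
        norm_num
      have e2 : abundancy (2 ^ 2) = 7 / 4 := by
        rw [abundancy, show sigma1 (2 ^ 2) = 7 by decide]
        norm_num
      rw [h, e1, e2] at h1
      norm_num at h1
    · exact ⟨1, le_rfl, by norm_num,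
        (reciprocalSum_le N 3 _ (by norm_num) h1).trans (by norm_num)⟩
  have hgeom := sum_Icc_inv_pow_le (x := 2) (by norm_num) N
  have hsingle : (1 / 2 : ℝ) ^ j * (1 - a j) ≤
      ∑ k ∈ Finset.Icc 1 N, (1 / 2 : ℝ) ^ k * (1 - a k) :=
    Finset.single_le_sum (f := fun k => (1 / 2 : ℝ) ^ k * (1 - a k))
      (fun k _ => mul_nonneg (by positivity) (sub_nonneg.2 (ha1 k)))
      (Finset.mem_Icc.2 ⟨hj1, hj2.trans hN⟩)
  simp only [mul_sub, mul_one, Finset.sum_sub_distrib] at hsingle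
  have hpow : (1 / 4 : ℝ) ≤ (1 / 2) ^ j := by interval_cases j <;> norm_num
  nlinarith

theorem reciprocalSum_two_le {N : ℕ} (hN : 2 ≤ N) {q : ℚ} (hq : q ≠ 1) :
    reciprocalSum (N + 1) 2 q ≤ 11 / 12 := by
  by_cases hden : q.den = 1
  · have h2 := reciprocalSum_succ_le_of_den_eq_one (reciprocalSum_le N) hden Nat.prime_two
    have h3 := reciprocalSum_succ_le_of_den_eq_one (reciprocalSum_le N) hden Nat.prime_three
    have h4 := reciprocalSum_le_succ_of_not_prime (n := 4) (by norm_num) (N + 1) q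
    have h5 := reciprocalSum_le (N + 1) 5 q (by norm_num) hq
    norm_num at h2 h3 h4 h5
    linarith
  · have hp := Nat.minFac_prime hden
    rcases hp.eq_two_or_odd' with h2 | hodd
    · refine (reciprocalSum_le_of_two_dvd_den hN ?_).trans (by norm_num)
      exact h2 ▸ q.den.minFac_dvd
    · have h3 : (3 : ℝ) ≤ q.den.minFac := by
        have := hp.two_le
        have h3 : 3 ≤ q.den.minFac := by
          obtain ⟨m, hm⟩ := hodd
          omega
        exact_mod_cast h3
      calc reciprocalSum (N + 1) 2 q ≤ 1 / ((q.den.minFac : ℝ) - 1) :=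
            reciprocalSum_le_of_prime_dvd_den (fun q' => reciprocalSum_le_one le_rfl q') hp
              q.den.minFac_dvd
        _ ≤ 1 / 2 := one_div_le_one_div_of_le (by norm_num) (by linarith)
        _ ≤ 11 / 12 := by norm_num

theorem stmt16 (q : ℚ) (hq : 0 < q) (hq1 : q ≠ 1) :
    ∑' d : {d : ℕ // 0 < d ∧ (sigma1 d : ℚ) / d = q}, (1 : ℝ≥0∞) / (d.1 : ℝ≥0∞) < 1 := by
  have hlt : ENNReal.ofReal (11 / 12) < 1 := by
    rw [← ENNReal.ofReal_one]
    exact (ENNReal.ofReal_lt_ofReal_iff one_pos).2 (by norm_num)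
  refine lt_of_le_of_lt ?_ hlt
  rw [ENNReal.tsum_eq_iSup_sum]
  refine iSup_le fun s => ?_
  have hterm : ∀ d ∈ s, (1 : ℝ≥0∞) / (d.1 : ℝ≥0∞) = ENNReal.ofReal (1 / (d.1 : ℝ)) := by
    intro d _
    rw [ENNReal.ofReal_div_of_pos (by exact_mod_cast d.2.1), ENNReal.ofReal_one,
      ENNReal.ofReal_natCast]
  rw [Finset.sum_congr rfl hterm, ← ENNReal.ofReal_sum_of_nonneg fun _ _ => by positivity]
  refine ENNReal.ofReal_le_ofReal (le_trans ?_
    (reciprocalSum_two_le (N := s.sup (fun d => d.1) + 2) (by omega) hq1))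
  refine (Finset.sum_map s (Function.Embedding.subtype _) fun d : ℕ => (1 : ℝ) / d).ge.trans ?_
  refine Finset.sum_le_sum_of_subset_of_nonneg ?_ fun _ _ _ => by positivity
  intro d hd
  obtain ⟨x, hx, rfl⟩ := Finset.mem_map.1 hd
  have hxs : x.1 ≤ s.sup (fun d => d.1) := Finset.le_sup (f := fun d => d.1) hx
  exact mem_levelSet.2 ⟨by simp only [Function.Embedding.subtype_apply]; omega, x.2.1, x.2.2,
    fun r hr => (Nat.prime_of_mem_primeFactors hr).two_le⟩
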